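/- Let T be a quasi-multiplication operator on a complex Banach space X such that 1 ∈ σ(T) and σ(T) ⊆ 𝔻 ∪ {1}. Define m(ε) = max_{ε≤|θ|≤π} 1/dist(e^{iθ},σ(T)) and m_max(ε) = max_{ε≤θ≤π} m(θ) log(θ/ε) for ε ∈ (0,π]. Suppose δ ∈ (0,1) is such that min_{ε≤|θ|≤π} dist(e^{iθ},σ(T)) ≤ δε for all sufficiently small ε ∈ (0,π], and let δ' ∈ (δ,1) and c > 1. Then ‖Tⁿ(I − T)‖ ≥ (1 − δ') m_max⁻¹(cn) for all sufficiently large n ≥ 1. -/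

import Mathlib

open Filter Topology

/-- The right inverse `M⁻¹(s) = inf {ε ∈ (0,π] : M ε ≤ s}` of a continuous
non-increasing function `M : (0,π] → (0,∞)`. -/
noncomputable def rightInv (M : ℝ → ℝ) (s : ℝ) : ℝ :=
  sInf {ε : ℝ | ε ∈ Set.Ioc 0 Real.pi ∧ M ε ≤ s}

/-- `T` is a quasi-multiplication operator: `‖p(T) q(T)⁻¹‖ = sup_{λ ∈ σ(T)} |p(λ)/q(λ)|`
for all polynomials `p, q` with `q` having no zeros on `σ(T)`. -/
def IsQuasiMultiplication {X : Type*} [NormedAddCommGroup X] [NormedSpace ℂ X]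
    (T : X →L[ℂ] X) : Prop :=
  ∀ p q : Polynomial ℂ, (∀ z ∈ spectrum ℂ T, q.eval z ≠ 0) →
    IsUnit (Polynomial.aeval T q) ∧
      ‖Polynomial.aeval T p * Ring.inverse (Polynomial.aeval T q)‖ =
        sSup ((fun z : ℂ => ‖p.eval z / q.eval z‖) '' spectrum ℂ T)

/-- `m(ε) = max_{ε ≤ |θ| ≤ π} 1 / dist(e^{iθ}, S)`. -/
noncomputable def mDist (S : Set ℂ) (ε : ℝ) : ℝ :=
  sSup ((fun θ : ℝ => (Metric.infDist (Complex.exp (Complex.I * θ)) S)⁻¹) ''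
    {θ : ℝ | ε ≤ |θ| ∧ |θ| ≤ Real.pi})

/-- `m_max(ε) = max_{ε ≤ θ ≤ π} m(θ) log(θ/ε)`. -/
noncomputable def mMax (m : ℝ → ℝ) (ε : ℝ) : ℝ :=
  sSup ((fun θ : ℝ => m θ * Real.log (θ / ε)) '' Set.Icc ε Real.pi)

lemma two_mul_sin_half_le_norm {t φ : ℝ} (ht : 0 ≤ t) (hφ : t ≤ |φ|) (hπ : |φ| ≤ Real.pi) :
    2 * Real.sin (t / 2) ≤ ‖Complex.exp (Complex.I * φ) - 1‖ := by
  rw [Complex.norm_exp_I_mul_ofReal_sub_one, norm_mul, Real.norm_eq_abs, Real.norm_eq_abs, abs_two]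
  have h : Real.sin (t / 2) ≤ Real.sin (|φ| / 2) :=
    Real.sin_le_sin_of_le_of_le_pi_div_two (by linarith [Real.pi_pos]) (by linarith) (by linarith)
  have h' : Real.sin (|φ| / 2) ≤ |Real.sin (φ / 2)| := by
    rcases abs_cases φ with ⟨h, _⟩ | ⟨h, _⟩
    · rw [h]; exact le_abs_self _
    · rw [h, neg_div, Real.sin_neg]; exact neg_le_abs _
  linarith

lemma infDist_exp_pos {S : Set ℂ} (hS : IsCompact S) (h1 : (1 : ℂ) ∈ S)
    (hσ : S ⊆ Metric.ball (0 : ℂ) 1 ∪ {1}) {φ : ℝ} (h0 : 0 < |φ|) (hπ : |φ| ≤ Real.pi) :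
    0 < Metric.infDist (Complex.exp (Complex.I * φ)) S := by
  refine (hS.isClosed.notMem_iff_infDist_pos ⟨1, h1⟩).1 fun hmem => ?_
  rcases hσ hmem with h | h
  · rw [mem_ball_zero_iff, mul_comm, Complex.norm_exp_ofReal_mul_I] at h
    exact lt_irrefl _ h
  · have := two_mul_sin_half_le_norm h0.le le_rfl hπ
    rw [Set.mem_singleton_iff.1 h, sub_self, norm_zero] at this
    have := Real.sin_pos_of_pos_of_lt_pi (x := |φ| / 2) (by linarith) (by linarith)
    linarith

lemma bddAbove_inv_infDist {S : Set ℂ} (hS : IsCompact S) (h1 : (1 : ℂ) ∈ S)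
    (hσ : S ⊆ Metric.ball (0 : ℂ) 1 ∪ {1}) {ε : ℝ} (hε : 0 < ε) :
    BddAbove ((fun θ : ℝ => (Metric.infDist (Complex.exp (Complex.I * θ)) S)⁻¹) ''
      {θ : ℝ | ε ≤ |θ| ∧ |θ| ≤ Real.pi}) := by
  have hK : IsCompact {θ : ℝ | ε ≤ |θ| ∧ |θ| ≤ Real.pi} := by
    refine (isCompact_Icc (a := -Real.pi) (b := Real.pi)).of_isClosed_subset ?_
      fun θ hθ => abs_le.1 hθ.2
    exact (isClosed_le continuous_const continuous_abs).inter
      (isClosed_le continuous_abs continuous_const)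
  refine hK.bddAbove_image (ContinuousOn.inv₀ ?_ fun θ hθ =>
    (infDist_exp_pos hS h1 hσ (hε.trans_le hθ.1) hθ.2).ne')
  exact ((Metric.continuous_infDist_pt S).comp (by fun_prop)).continuousOn

lemma mDist_anti {S : Set ℂ} (hS : IsCompact S) (h1 : (1 : ℂ) ∈ S)
    (hσ : S ⊆ Metric.ball (0 : ℂ) 1 ∪ {1}) {s t : ℝ} (hs : 0 < s) (hst : s ≤ t)
    (ht : t ≤ Real.pi) : mDist S t ≤ mDist S s := by
  refine csSup_le_csSup (bddAbove_inv_infDist hS h1 hσ hs) ?_ ?_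
  · exact ⟨_, Real.pi, ⟨by rwa [abs_of_pos Real.pi_pos], by rw [abs_of_pos Real.pi_pos]⟩, rfl⟩
  · exact Set.image_mono fun θ hθ => ⟨hst.trans hθ.1, hθ.2⟩

lemma mDist_nonneg (S : Set ℂ) (t : ℝ) : 0 ≤ mDist S t := by
  apply Real.sSup_nonneg
  rintro _ ⟨θ, -, rfl⟩
  exact inv_nonneg.2 Metric.infDist_nonneg

lemma le_mMax_mDist {S : Set ℂ} (hS : IsCompact S) (h1 : (1 : ℂ) ∈ S)
    (hσ : S ⊆ Metric.ball (0 : ℂ) 1 ∪ {1}) {ε θ : ℝ} (hε : 0 < ε) (hεθ : ε ≤ θ)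
    (hθ : θ ≤ Real.pi) : mDist S θ * Real.log (θ / ε) ≤ mMax (mDist S) ε := by
  refine le_csSup ⟨mDist S ε * Real.log (Real.pi / ε), ?_⟩ ⟨θ, ⟨hεθ, hθ⟩, rfl⟩
  rintro _ ⟨t, ht, rfl⟩
  have ht0 : 0 < t := hε.trans_le ht.1
  refine mul_le_mul (mDist_anti hS h1 hσ hε ht.1 ht.2) ?_ ?_ (mDist_nonneg _ _)
  · exact Real.log_le_log (by positivity) (by gcongr; exact ht.2)
  · exact Real.log_nonneg ((one_le_div hε).2 ht.1)

lemma inv_le_mDist {S : Set ℂ} (hS : IsCompact S) (h1 : (1 : ℂ) ∈ S)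
    (hσ : S ⊆ Metric.ball (0 : ℂ) 1 ∪ {1}) {ε a : ℝ} (hε : 0 < ε)
    (h : ∃ θ : ℝ, ε ≤ |θ| ∧ |θ| ≤ Real.pi ∧
      Metric.infDist (Complex.exp (Complex.I * θ)) S ≤ a) :
    a⁻¹ ≤ mDist S ε := by
  obtain ⟨θ, hθ, hπ, hd⟩ := h
  exact (inv_anti₀ (infDist_exp_pos hS h1 hσ (hε.trans_le hθ) hπ) hd).trans
    (le_csSup (bddAbove_inv_infDist hS h1 hσ hε) (Set.mem_image_of_mem _ ⟨hθ, hπ⟩))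

lemma mMax_pi (m : ℝ → ℝ) : mMax m Real.pi = 0 := by
  simp [mMax]

lemma lt_mMax_of_lt_rightInv {M : ℝ → ℝ} {s ε : ℝ} (hε : 0 < ε) (hπ : ε ≤ Real.pi)
    (h : ε < rightInv M s) : s < M ε := by
  by_contra! hle
  have hmem : ε ∈ {ε : ℝ | ε ∈ Set.Ioc 0 Real.pi ∧ M ε ≤ s} := ⟨⟨hε, hπ⟩, hle⟩
  exact absurd (csInf_le ⟨0, fun _ hx => hx.1.1.le⟩ hmem) (not_le.2 h)

lemma rightInv_mMax_le_pi (m : ℝ → ℝ) {s : ℝ} (hs : 0 ≤ s) :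
    rightInv (mMax m) s ≤ Real.pi :=
  csInf_le ⟨0, fun _ hx => hx.1.1.le⟩ ⟨⟨Real.pi_pos, le_rfl⟩, by rwa [mMax_pi]⟩

/-- If `m(ε) ≥ (δε)⁻¹` near `0`, then `m_max⁻¹(s)` decays no faster than `1/s`. -/
lemma le_rightInv_mMax {S : Set ℂ} (hS : IsCompact S) (h1 : (1 : ℂ) ∈ S)
    (hσ : S ⊆ Metric.ball (0 : ℂ) 1 ∪ {1}) {δ ε₀ s : ℝ} (hδ : 0 < δ) (hεπ : ε₀ ≤ Real.pi)
    (hm : ∀ ε, 0 < ε → ε < ε₀ → (δ * ε)⁻¹ ≤ mDist S ε) (hs : 0 < s) :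
    min (ε₀ / Real.exp 1) (1 / (δ * Real.exp 1 * s)) ≤ rightInv (mMax (mDist S)) s := by
  refine le_csInf ⟨Real.pi, ⟨Real.pi_pos, le_rfl⟩, by rw [mMax_pi]; exact hs.le⟩ ?_
  rintro ε ⟨⟨hε, -⟩, hM⟩
  have he := Real.exp_pos 1
  by_cases h : ε < ε₀ / Real.exp 1
  · refine (min_le_right _ _).trans ?_
    rw [lt_div_iff₀ he] at h
    have h2 := le_mMax_mDist hS h1 hσ hε
      (le_mul_of_one_le_right hε.le (Real.one_le_exp zero_le_one)) (h.le.trans hεπ)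
    rw [mul_div_cancel_left₀ _ hε.ne', Real.log_exp, mul_one] at h2
    have h3 := ((hm _ (by positivity) h).trans h2).trans hM
    rw [inv_le_iff_one_le_mul₀ (by positivity)] at h3
    rw [div_le_iff₀ (by positivity)]
    linarith
  · exact (min_le_left _ _).trans (not_lt.1 h)

lemma exp_neg_mul_le_one_sub {c d : ℝ} (hc : 1 < c) (hd : 0 ≤ d) (hdc : c * d ≤ c - 1) :
    Real.exp (-(c * d)) ≤ 1 - d := by
  have hcd : 0 < 1 + c * d := by nlinarith
  rw [Real.exp_neg, inv_le_iff_one_le_mul₀ (Real.exp_pos _)]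
  have hd1 : 0 ≤ 1 - d := by nlinarith
  have := Real.add_one_le_exp (c * d)
  nlinarith [mul_le_mul_of_nonneg_left this hd1]

lemma norm_pow_mul_le {X : Type*} [NormedAddCommGroup X] [NormedSpace ℂ X]
    [CompleteSpace X] {T : X →L[ℂ] X} (hQM : IsQuasiMultiplication T) {z : ℂ}
    (hz : z ∈ spectrum ℂ T) (n : ℕ) : ‖z‖ ^ n * ‖1 - z‖ ≤ ‖T ^ n * (1 - T)‖ := by
  have h := (hQM (Polynomial.X ^ n * (1 - Polynomial.X)) 1 (by simp)).2
  simp only [map_mul, map_pow, Polynomial.aeval_X, map_sub, map_one, Ring.inverse_one, mul_one,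
    Polynomial.eval_mul, Polynomial.eval_pow, Polynomial.eval_X, Polynomial.eval_sub,
    Polynomial.eval_one, div_one, norm_mul, norm_pow] at h
  rw [h]
  exact le_csSup ((spectrum.isCompact T).bddAbove_image (by fun_prop)) ⟨z, hz, rfl⟩

lemma exists_mem_lower_bound {S : Set ℂ} (hS : IsCompact S) (h1 : (1 : ℂ) ∈ S)
    {δ₁ δ' c θ ε : ℝ} {n : ℕ} (hδ₁0 : 0 < δ₁) (hδ₁ : δ₁ < δ') (hδ' : δ' < 1) (hc : 1 < c)
    (hn : 0 < n) (hε : 0 < ε) (hεθ : ε ≤ θ) (hθ1 : θ ≤ 1) (hθδ : θ ≤ δ' - δ₁)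
    (hθc : c * θ ≤ c - 1) (hm : (δ₁ * θ)⁻¹ < mDist S θ)
    (hM : c * n < mDist S θ * Real.log (θ / ε)) :
    ∃ z ∈ S, (1 - δ') * ε ≤ ‖z‖ ^ n * ‖1 - z‖ := by
  have hθ : 0 < θ := hε.trans_le hεθ
  have hcn : 0 < c * n := by positivity
  have hlog : 0 < Real.log (θ / ε) := by
    by_contra! h
    nlinarith [mDist_nonneg S θ]
  rw [← div_lt_iff₀ hlog] at hM
  obtain ⟨_, ⟨φ, ⟨hφ, hφπ⟩, rfl⟩, hlt⟩ := exists_lt_of_lt_csSup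
    (by exact ⟨_, Real.pi, ⟨by rw [abs_of_pos Real.pi_pos]; linarith [Real.pi_gt_three],
      by rw [abs_of_pos Real.pi_pos]⟩, rfl⟩) (max_lt hm hM)
  obtain ⟨hd1, hd2⟩ := max_lt_iff.1 hlt
  obtain ⟨z, hz, hzd⟩ := hS.exists_infDist_eq_dist ⟨1, h1⟩ (Complex.exp (Complex.I * φ))
  simp only [hzd, dist_eq_norm] at hd1 hd2
  set d := ‖Complex.exp (Complex.I * φ) - z‖
  have hd0 : 0 < d := inv_pos.1 ((by positivity : 0 < (δ₁ * θ)⁻¹).trans hd1)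
  have hdθ : d < δ₁ * θ := (inv_lt_inv₀ (by positivity) hd0).1 hd1
  have hdlog : n * (c * d) ≤ Real.log (θ / ε) := by
    rw [div_lt_iff₀ hlog, ← div_eq_inv_mul, lt_div_iff₀ hd0] at hd2
    linarith
  have hdθ' : d ≤ θ := by nlinarith
  have hz1 : 1 - d ≤ ‖z‖ := by
    have := norm_sub_norm_le (Complex.exp (Complex.I * φ)) z
    rw [mul_comm, Complex.norm_exp_ofReal_mul_I, mul_comm] at this
    linarith
  have hpow : ε / θ ≤ ‖z‖ ^ n := calc
    ε / θ = Real.exp (-Real.log (θ / ε)) := by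
      rw [Real.exp_neg, Real.exp_log (by positivity), inv_div]
    _ ≤ Real.exp (n * -(c * d)) := Real.exp_le_exp.2 (by linarith)
    _ = Real.exp (-(c * d)) ^ n := Real.exp_nat_mul _ _
    _ ≤ ‖z‖ ^ n := by
      gcongr
      exact (exp_neg_mul_le_one_sub hc hd0.le (by nlinarith)).trans hz1
  have hdist : (1 - δ') * θ ≤ ‖1 - z‖ := by
    have h2 := two_mul_sin_half_le_norm hθ.le hφ hφπ
    have h3 := Real.sin_gt_sub_cube (x := θ / 2) (by positivity)
    have h4 := norm_sub_le_norm_sub_add_norm_sub (Complex.exp (Complex.I * φ)) z 1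
    rw [norm_sub_rev z 1] at h4
    have h5 : θ ^ 2 ≤ δ' - δ₁ := by nlinarith
    have h6 : θ ^ 3 ≤ (δ' - δ₁) * θ := by nlinarith
    nlinarith [pow_pos hθ 3]
  refine ⟨z, hz, ?_⟩
  calc (1 - δ') * ε = ε / θ * ((1 - δ') * θ) := by field_simp
    _ ≤ ‖z‖ ^ n * ‖1 - z‖ := by
      have : 0 ≤ 1 - δ' := by linarith
      gcongr

lemma eventually_mul_log_le (M A : ℝ) {c : ℝ} (hM : 0 ≤ M) (hA : 0 < A) (hc : 0 < c) :
    ∀ᶠ n : ℕ in atTop, M * Real.log (A * n) ≤ c * n := by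
  have ht : Tendsto (fun n : ℕ => A * (n : ℝ)) atTop atTop :=
    tendsto_natCast_atTop_atTop.const_mul_atTop hA
  have h := (Real.isLittleO_log_id_atTop.comp_tendsto ht).bound
    (show 0 < c / ((M + 1) * A) by positivity)
  filter_upwards [h] with n hn
  simp only [Function.comp, id, Real.norm_eq_abs] at hn
  rw [abs_of_nonneg (show 0 ≤ A * (n : ℝ) by positivity)] at hn
  have h2 : Real.log (A * n) ≤ c * n / (M + 1) := by
    refine (le_abs_self _).trans (hn.trans_eq ?_)
    field_simp
  calc M * Real.log (A * n) ≤ M * (c * n / (M + 1)) := by gcongr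
    _ = c * n * (M / (M + 1)) := by ring
    _ ≤ c * n * 1 := by
      gcongr
      exact (div_le_one (by positivity)).2 (by linarith)
    _ = c * n := mul_one _

/-- Lower bound for quasi-multiplication operators:
`‖Tⁿ(I-T)‖ ≥ (1-δ') m_max⁻¹(cn)` for all sufficiently large `n`. -/
theorem quasiMult_lower_bound {X : Type*} [NormedAddCommGroup X] [NormedSpace ℂ X]
    [CompleteSpace X] (T : X →L[ℂ] X)
    (hQM : IsQuasiMultiplication T)
    (h1 : (1:ℂ) ∈ spectrum ℂ T)
    (hσ : spectrum ℂ T ⊆ Metric.ball (0:ℂ) 1 ∪ {1})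
    (δ : ℝ) (hδ : δ ∈ Set.Ioo (0:ℝ) 1)
    (hmin : ∀ᶠ ε in nhdsWithin (0:ℝ) (Set.Ioi 0), ∃ θ : ℝ, ε ≤ |θ| ∧ |θ| ≤ Real.pi ∧
      Metric.infDist (Complex.exp (Complex.I * θ)) (spectrum ℂ T) ≤ δ * ε)
    (δ' : ℝ) (hδ' : δ' ∈ Set.Ioo δ 1) (c : ℝ) (hc : 1 < c) :
    ∀ᶠ n : ℕ in Filter.atTop,
      (1 - δ') * rightInv (mMax (mDist (spectrum ℂ T))) (c * n) ≤ ‖T ^ n * (1 - T)‖ := by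
  obtain ⟨hδ0, -⟩ := hδ
  obtain ⟨hδδ', hδ'1⟩ := hδ'
  have hS := spectrum.isCompact (𝕜 := ℂ) T
  set S := spectrum ℂ T
  obtain ⟨ε₁, hε₁, hmin⟩ := (nhdsGT_basis (0 : ℝ)).eventually_iff.1 hmin
  obtain ⟨δ₁, hδδ₁, hδ₁⟩ := exists_between hδδ'
  have hm : ∀ ε, 0 < ε → ε < min ε₁ Real.pi → (δ * ε)⁻¹ ≤ mDist S ε := fun ε h0 h =>
    inv_le_mDist hS h1 hσ h0 (hmin ⟨h0, h.trans_le (min_le_left _ _)⟩)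
  have hε₀ : 0 < min ε₁ Real.pi := lt_min hε₁ Real.pi_pos
  set ε₀ := min ε₁ Real.pi
  have hε₀π : ε₀ ≤ Real.pi := min_le_right _ _
  have hc0 : 0 < c := by linarith
  obtain ⟨θ₀, hθ₀, hθ₀lt⟩ : ∃ θ₀, 0 < θ₀ ∧
      θ₀ < min (min ε₀ 1) (min (δ' - δ₁) ((c - 1) / c)) :=
    exists_between (lt_min (lt_min hε₀ one_pos)
      (lt_min (by linarith) (div_pos (by linarith) hc0)))
  obtain ⟨⟨hθ₀ε, hθ₀1⟩, hθ₀δ, hθ₀c⟩ := by simpa only [lt_min_iff] using hθ₀lt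
  rw [lt_div_iff₀ hc0] at hθ₀c
  have he := Real.exp_pos 1
  set K := 1 / (δ * Real.exp 1 * c) with hK
  have hK0 : 0 < K := by positivity
  have hKn : ∀ᶠ n : ℕ in atTop, K / n ≤ ε₀ / Real.exp 1 :=
    ((tendsto_const_div_atTop_nhds_zero_nat K).eventually_lt_const
      (div_pos hε₀ he)).mono fun _ h => h.le
  filter_upwards [hKn, eventually_gt_atTop 0, eventually_mul_log_le (mDist S θ₀)
    (2 * Real.pi / K) (mDist_nonneg _ _) (by positivity) hc0] with n hKn hn hlogn
  have hn' : (0 : ℝ) < n := by exact_mod_cast hn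
  have hcn : 0 < c * n := by positivity
  have hr : K / n ≤ rightInv (mMax (mDist S)) (c * n) := by
    refine le_trans (le_min hKn (le_of_eq ?_)) (le_rightInv_mMax hS h1 hσ hδ0 hε₀π hm hcn)
    rw [hK, div_div, mul_assoc _ c]
  have hrπ := rightInv_mMax_le_pi (mDist S) hcn.le
  set r := rightInv (mMax (mDist S)) (c * n)
  by_contra! hlt
  have hδ'0 : 0 < 1 - δ' := by linarith
  have hr0 : 0 < r := (div_pos hK0 hn').trans_le hr
  obtain ⟨ε, hεmax, hεr⟩ := exists_between
    (max_lt ((div_lt_iff₀' hδ'0).2 hlt) (half_lt_self hr0))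
  obtain ⟨hεN, hε2⟩ := max_lt_iff.1 hεmax
  rw [div_lt_iff₀' hδ'0] at hεN
  have hε : 0 < ε := by linarith
  have hM := lt_mMax_of_lt_rightInv hε (hεr.le.trans hrπ) hεr
  obtain ⟨_, ⟨θ, ⟨hεθ, hθπ⟩, rfl⟩, hθM⟩ :=
    exists_lt_of_lt_csSup ((Set.nonempty_Icc.2 (hεr.le.trans hrπ)).image _) hM
  have hθ : 0 < θ := hε.trans_le hεθ
  have hθθ₀ : θ < θ₀ := by
    by_contra! h
    refine absurd (hθM.trans_le ?_) (not_lt.2 hlogn)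
    refine mul_le_mul (mDist_anti hS h1 hσ hθ₀ h hθπ) ?_
      (Real.log_nonneg ((one_le_div hε).2 hεθ)) (mDist_nonneg _ _)
    refine Real.log_le_log (by positivity) ?_
    rw [div_le_iff₀ hε]
    have hKε : K ≤ 2 * ε * n := by
      rw [div_le_iff₀ hn'] at hr
      nlinarith
    have : 1 ≤ 2 * ε * n / K := (one_le_div hK0).2 hKε
    calc θ ≤ Real.pi * 1 := by linarith
      _ ≤ Real.pi * (2 * ε * n / K) := by gcongr
      _ = 2 * Real.pi / K * n * ε := by ring
  have hmθ : (δ₁ * θ)⁻¹ < mDist S θ := by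
    refine lt_of_lt_of_le ?_ (hm θ hθ (hθθ₀.trans hθ₀ε))
    exact inv_strictAnti₀ (by positivity) (by gcongr)
  obtain ⟨z, hz, hzb⟩ := exists_mem_lower_bound hS h1 (hδ0.trans hδδ₁) hδ₁ hδ'1 hc hn hε hεθ
    (by linarith) (by linarith) (by nlinarith) hmθ hθM
  exact absurd (hzb.trans (norm_pow_mul_le hQM hz n)) (not_le.2 hεN)
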